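/- Let Σ₀ be a real symmetric positive definite p×p matrix with smallest eigenvalue λ_min(Σ₀), let ε ∈ (0, λ_min(Σ₀)), let λ > 0, and let Σ̂₁, …, Σ̂_M be real symmetric p×p matrices such that |(Σ̂_k)_{ij} − (Σ₀)_{ij}| ≤ λ for all 1 ≤ i, j ≤ p and 1 ≤ k ≤ M. Let s₀ be the number of nonzero off-diagonal entries of Σ₀, and let Σ̂⁺ be a minimizer of Σ ↦ (1/(2M))Σ_{k=1}^M ‖Σ − Σ̂_k‖²_F + λ|Σ|₁ over symmetric Σ with Σ ⪰ εI. Then ‖Σ̂⁺ − Σ₀‖_F ≤ 5λ√(s₀ + p). -/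

import Mathlib

open Matrix

/-- The Frobenius norm of a real `p × p` matrix. -/
noncomputable def frobNorm {p : ℕ} (A : Matrix (Fin p) (Fin p) ℝ) : ℝ :=
  Real.sqrt (∑ i, ∑ j, (A i j) ^ 2)

/-- The L1 norm of the off-diagonal entries: `|Σ|₁ = ∑_{i ≠ j} |σ_{ij}|`. -/
noncomputable def offDiagL1 {p : ℕ} (A : Matrix (Fin p) (Fin p) ℝ) : ℝ :=
  ∑ i, ∑ j, if i = j then 0 else |A i j|

/-- The number of nonzero off-diagonal entries of a real `p × p` matrix. -/
noncomputable def offDiagSupport {p : ℕ} (A : Matrix (Fin p) (Fin p) ℝ) : ℕ :=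
  (Finset.univ.filter fun ij : Fin p × Fin p => ij.1 ≠ ij.2 ∧ A ij.1 ij.2 ≠ 0).card

lemma entry_bound (a b c lam : ℝ) (hlam : 0 < lam) (h : |c - b| ≤ lam) :
    (b - c) ^ 2 / 2 + lam * |b| + (a - b) ^ 2 / 4 - (if b = 0 then 0 else 4 * lam ^ 2)
      ≤ (a - c) ^ 2 / 2 + lam * |a| := by
  obtain ⟨h1, h2⟩ := abs_le.mp h
  split_ifs with hb
  · subst hb
    have : c * a ≤ lam * |a| := by
      calc c * a ≤ |c * a| := le_abs_self _
        _ = |c| * |a| := abs_mul _ _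
        _ ≤ lam * |a| := by
          apply mul_le_mul_of_nonneg_right _ (abs_nonneg _)
          simpa using h
    simp only [abs_zero]
    nlinarith [sq_nonneg a]
  · have h3 : |b| ≤ |a| + |a - b| := by
      have := abs_sub_abs_le_abs_sub b a
      rw [abs_sub_comm b a] at this
      linarith
    have h4 : (c - b) * (a - b) ≤ lam * |a - b| := by
      calc (c - b) * (a - b) ≤ |(c - b) * (a - b)| := le_abs_self _
        _ = |c - b| * |a - b| := abs_mul _ _
        _ ≤ lam * |a - b| := mul_le_mul_of_nonneg_right h (abs_nonneg _)
    have h5 := mul_le_mul_of_nonneg_left h3 hlam.le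
    nlinarith [sq_nonneg (|a - b| / 2 - 2 * lam), sq_abs (a - b)]

lemma entry_bound_diag (a b c lam : ℝ) (h : |c - b| ≤ lam) :
    (b - c) ^ 2 / 2 + (a - b) ^ 2 / 4 - 4 * lam ^ 2 ≤ (a - c) ^ 2 / 2 := by
  have h4 : (c - b) ^ 2 ≤ lam ^ 2 := by
    rw [← sq_abs]
    exact pow_le_pow_left₀ (abs_nonneg _) h 2
  nlinarith [sq_nonneg ((a - b) / 2 - (c - b))]

lemma frobNorm_sq {p : ℕ} (A : Matrix (Fin p) (Fin p) ℝ) :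
    frobNorm A ^ 2 = ∑ i, ∑ j, (A i j) ^ 2 := by
  unfold frobNorm
  exact Real.sq_sqrt (Finset.sum_nonneg fun i _ => Finset.sum_nonneg fun j _ => sq_nonneg _)

lemma support_sum {p : ℕ} (A : Matrix (Fin p) (Fin p) ℝ) :
    (offDiagSupport A : ℝ) + p =
      ∑ i, ∑ j, (if i = j then (1 : ℝ) else if A i j = 0 then 0 else 1) := by
  have h : ∀ i j : Fin p, (if i = j then (1 : ℝ) else if A i j = 0 then 0 else 1) =
      (if i ≠ j ∧ A i j ≠ 0 then (1 : ℝ) else 0) + (if i = j then 1 else 0) := by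
    intro i j
    by_cases h1 : i = j <;> by_cases h2 : A i j = 0 <;> simp [h1, h2]
  simp_rw [h, Finset.sum_add_distrib]
  congr 1
  · unfold offDiagSupport
    rw [Finset.card_filter, Nat.cast_sum, Fintype.sum_prod_type]
    simp
  · simp

lemma per_sample {p : ℕ} (A B C : Matrix (Fin p) (Fin p) ℝ) (lam : ℝ) (hlam : 0 < lam)
    (h : ∀ i j, |C i j - B i j| ≤ lam) :
    frobNorm (B - C) ^ 2 / 2 + lam * offDiagL1 B + frobNorm (A - B) ^ 2 / 4
      - 4 * lam ^ 2 * ((offDiagSupport B : ℝ) + p)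
      ≤ frobNorm (A - C) ^ 2 / 2 + lam * offDiagL1 A := by
  rw [support_sum, frobNorm_sq, frobNorm_sq, frobNorm_sq]
  unfold offDiagL1
  simp only [Finset.mul_sum, Finset.sum_div, ← Finset.sum_add_distrib, ← Finset.sum_sub_distrib]
  refine Finset.sum_le_sum fun i _ => Finset.sum_le_sum fun j _ => ?_
  simp only [Matrix.sub_apply]
  by_cases hij : i = j
  · have := entry_bound_diag (A i j) (B i j) (C i j) lam (h i j)
    simp only [hij, if_true] at this ⊢
    linarith
  · have := entry_bound (A i j) (B i j) (C i j) lam hlam (h i j)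
    simp only [hij, if_false]
    split_ifs at this ⊢ <;> linarith

lemma feasible {p : ℕ} (A : Matrix (Fin p) (Fin p) ℝ) (hA : A.IsHermitian) (ε : ℝ)
    (h : ∀ i, ε < hA.eigenvalues i) : (A - ε • (1 : Matrix (Fin p) (Fin p) ℝ)).PosSemidef := by
  set U : Matrix (Fin p) (Fin p) ℝ := (hA.eigenvectorUnitary : Matrix (Fin p) (Fin p) ℝ) with hU
  have h1 : U * Uᴴ = 1 := Unitary.coe_mul_star_self hA.eigenvectorUnitary
  have h2 : A = U * Matrix.diagonal hA.eigenvalues * Uᴴ := by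
    have := hA.spectral_theorem
    rw [Unitary.conjStarAlgAut_apply] at this
    exact this
  have h3 : A - ε • (1 : Matrix (Fin p) (Fin p) ℝ) =
      U * Matrix.diagonal (fun i => hA.eigenvalues i - ε) * Uᴴ := by
    have h4 : Matrix.diagonal (fun i => hA.eigenvalues i - ε) =
        Matrix.diagonal hA.eigenvalues - ε • (1 : Matrix (Fin p) (Fin p) ℝ) := by
      rw [Matrix.smul_one_eq_diagonal, Matrix.diagonal_sub]
    rw [h4, mul_sub, sub_mul, ← h2]
    rw [Matrix.mul_smul, Matrix.mul_one, Matrix.smul_mul, h1]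
  rw [h3]
  exact (Matrix.PosSemidef.diagonal fun i => (sub_pos.mpr (h i)).le).mul_mul_conjTranspose_same U

/-- **Deterministic error bound (core of Theorems 3 and 4).**  Let `Sig0` be symmetric
positive definite with all eigenvalues `> ε > 0`, `lam > 0`, and let `Sighat k` be
symmetric with `|(Sighat k)ᵢⱼ − (Sig0)ᵢⱼ| ≤ lam` entrywise.  If `Sigp` minimizes
`Σ ↦ (1/(2M)) ∑ k ‖Σ − Sighat k‖²_F + lam |Σ|₁` over symmetric `Σ ⪰ εI`, then
`‖Sigp − Sig0‖_F ≤ 5 lam √(s₀ + p)`, where `s₀` is the number of nonzero off-diagonal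
entries of `Sig0`. -/
theorem ensemble_estimator_error_bound {p M : ℕ} (hM : 0 < M)
    (Sig0 : Matrix (Fin p) (Fin p) ℝ) (hSig0 : Sig0.PosDef)
    (ε : ℝ) (hε : 0 < ε) (hεmin : ∀ i : Fin p, ε < hSig0.1.eigenvalues i)
    (lam : ℝ) (hlam : 0 < lam)
    (Sighat : Fin M → Matrix (Fin p) (Fin p) ℝ)
    (hsymm : ∀ k, (Sighat k).IsSymm)
    (hclose : ∀ (k : Fin M) (i j : Fin p), |Sighat k i j - Sig0 i j| ≤ lam)
    (Sigp : Matrix (Fin p) (Fin p) ℝ)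
    (hSigpSymm : Sigp.IsSymm)
    (hSigpFeas : (Sigp - ε • (1 : Matrix (Fin p) (Fin p) ℝ)).PosSemidef)
    (hSigpMin : ∀ T : Matrix (Fin p) (Fin p) ℝ, T.IsSymm →
      (T - ε • (1 : Matrix (Fin p) (Fin p) ℝ)).PosSemidef →
      (1 / (2 * (M : ℝ))) * ∑ k, (frobNorm (Sigp - Sighat k)) ^ 2 + lam * offDiagL1 Sigp ≤
        (1 / (2 * (M : ℝ))) * ∑ k, (frobNorm (T - Sighat k)) ^ 2 + lam * offDiagL1 T) :
    frobNorm (Sigp - Sig0) ≤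
      5 * lam * Real.sqrt ((offDiagSupport Sig0 : ℝ) + (p : ℝ)) := by
  have hsym0 : Sig0.IsSymm := by
    have := hSig0.1
    rwa [Matrix.IsHermitian, Matrix.conjTranspose_eq_transpose_of_trivial] at this
  have hmin := hSigpMin Sig0 hsym0 (feasible Sig0 hSig0.1 ε hεmin)
  have hM' : (0 : ℝ) < M := by exact_mod_cast hM
  have hs := Finset.sum_le_sum fun (k : Fin M) (_ : k ∈ Finset.univ) =>
    per_sample Sigp Sig0 (Sighat k) lam hlam (hclose k)
  simp only [Finset.sum_add_distrib, Finset.sum_sub_distrib, ← Finset.sum_div, Finset.sum_const,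
    Finset.card_univ, Fintype.card_fin, nsmul_eq_mul] at hs
  have hmin2 := mul_le_mul_of_nonneg_left hmin hM'.le
  have e : ∀ x y : ℝ, (M : ℝ) * (1 / (2 * (M : ℝ)) * x + y) = x / 2 + M * y := by
    intro x y
    field_simp
  rw [e, e] at hmin2
  set N : ℝ := (offDiagSupport Sig0 : ℝ) + (p : ℝ) with hN
  have hN0 : 0 ≤ N := by positivity
  have h1 : (M : ℝ) * (frobNorm (Sigp - Sig0) ^ 2 / 4) ≤ M * (4 * lam ^ 2 * N) := by
    linarith
  have h2 := le_of_mul_le_mul_left h1 hM'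
  have h0 : 0 ≤ frobNorm (Sigp - Sig0) := Real.sqrt_nonneg _
  refine (sq_le_sq₀ h0 (by positivity)).mp ?_
  rw [mul_pow, Real.sq_sqrt hN0]
  nlinarith [mul_nonneg (sq_nonneg lam) hN0]
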